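/- arXiv:2003.07159 — 6 statements merged into one kernel-verified Lean document; each statement's English description precedes it below -/
import Mathlib

section
/- For all natural numbers p, q and all k ≥ 1, the real geometric algebra 𝒢_{p+k,q+k} is isomorphic as an ℝ-algebra to the algebra M_{2^k}(𝒢_{p,q}) of 2^k × 2^k matrices with entries in the real geometric algebra 𝒢_{p,q}. -/
/-- The quadratic form on `ℝ^{p+q}` (indexed by `Fin p ⊕ Fin q`) given by
`Q(x) = Σ_{i<p} x_i² − Σ_{j<q} y_j²`. -/
noncomputable def geomForm (p q : ℕ) : QuadraticForm ℝ ((Fin p ⊕ Fin q) → ℝ) :=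
  QuadraticMap.weightedSumSquares ℝ
    (Sum.elim (fun _ : Fin p => (1 : ℝ)) (fun _ : Fin q => (-1 : ℝ)))

/-- The real geometric algebra `𝒢_{p,q}`. -/
noncomputable abbrev GeometricAlgebra (p q : ℕ) : Type :=
  CliffordAlgebra (geomForm p q)

namespace CliffordAlgebra

section Hyperbolic

variable {R M : Type*} [CommRing R] [AddCommGroup M] [Module R M] (Q : QuadraticForm R M)

/-- The orthogonal sum of `Q` with the hyperbolic plane `(a, b) ↦ a * b`. -/
abbrev addHyperbolic : QuadraticForm R (M × R × R) :=
  Q.prod (QuadraticMap.linMulLin (LinearMap.fst R R R) (LinearMap.snd R R R))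

/-- The linear map `(m, a, b) ↦ !![ι m, a; b, -ι m]`. -/
def hyperbolicMatrix : M × R × R →ₗ[R] Matrix (Fin 2) (Fin 2) (CliffordAlgebra Q) where
  toFun x := !![ι Q x.1, algebraMap R _ x.2.1; algebraMap R _ x.2.2, -ι Q x.1]
  map_add' x y := by
    ext i j; fin_cases i <;> fin_cases j <;> simp [add_comm]
  map_smul' r x := by
    ext i j; fin_cases i <;> fin_cases j <;> simp [Algebra.smul_def]

/-- The algebra map from the Clifford algebra of `Q` plus a hyperbolic plane to the `2 × 2` matrices
over the Clifford algebra of `Q`. -/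
def toMatrix : CliffordAlgebra (addHyperbolic Q) →ₐ[R] Matrix (Fin 2) (Fin 2) (CliffordAlgebra Q) :=
  lift _ ⟨hyperbolicMatrix Q, fun x => by
    have hc : (algebraMap R (CliffordAlgebra Q) x.2.2) * ι Q x.1 = ι Q x.1 * algebraMap R _ x.2.2 :=
      Algebra.commutes _ _
    have hc' : (algebraMap R (CliffordAlgebra Q) x.2.1) * ι Q x.1 = ι Q x.1 * algebraMap R _ x.2.1 :=
      Algebra.commutes _ _
    ext i j
    fin_cases i <;> fin_cases j <;>
      simp [hyperbolicMatrix, Matrix.mul_apply, Matrix.algebraMap_matrix_apply, hc, hc', add_comm,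
        ← map_mul, mul_comm x.2.2]⟩

theorem toMatrix_ι (x : M × R × R) :
    toMatrix Q (ι _ x) = !![ι Q x.1, algebraMap R _ x.2.1; algebraMap R _ x.2.2, -ι Q x.1] :=
  lift_ι_apply _ _ _

/-- The first null vector of the hyperbolic plane. -/
def nullLeft : CliffordAlgebra (addHyperbolic Q) := ι _ (0, 1, 0)

/-- The second null vector of the hyperbolic plane. -/
def nullRight : CliffordAlgebra (addHyperbolic Q) := ι _ (0, 0, 1)

theorem nullLeft_mul_self : nullLeft Q * nullLeft Q = 0 := by
  simp [nullLeft]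

theorem nullRight_mul_self : nullRight Q * nullRight Q = 0 := by
  simp [nullRight]

theorem nullRight_mul_nullLeft :
    nullRight Q * nullLeft Q = 1 - nullLeft Q * nullRight Q := by
  rw [eq_sub_iff_add_eq, nullRight, nullLeft, ι_mul_ι_add_swap]
  simp [QuadraticMap.polar]

theorem nullLeft_mul_ι (m : M) :
    nullLeft Q * ι _ (m, 0, 0) = -(ι (addHyperbolic Q) (m, 0, 0) * nullLeft Q) := by
  rw [eq_neg_iff_add_eq_zero, nullLeft, ι_mul_ι_add_swap]
  simp [QuadraticMap.polar]

theorem nullRight_mul_ι (m : M) :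
    nullRight Q * ι _ (m, 0, 0) = -(ι (addHyperbolic Q) (m, 0, 0) * nullRight Q) := by
  rw [eq_neg_iff_add_eq_zero, nullRight, ι_mul_ι_add_swap]
  simp [QuadraticMap.polar]

/-- The commutator of the two null vectors, an involution. -/
def nullCommutator : CliffordAlgebra (addHyperbolic Q) :=
  nullLeft Q * nullRight Q - nullRight Q * nullLeft Q

theorem nullLeft_mul_nullRight_mul_nullLeft :
    nullLeft Q * nullRight Q * nullLeft Q = nullLeft Q := by
  rw [mul_assoc, nullRight_mul_nullLeft, mul_sub, ← mul_assoc, nullLeft_mul_self]; simp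

theorem nullRight_mul_nullLeft_mul_nullRight :
    nullRight Q * nullLeft Q * nullRight Q = nullRight Q := by
  rw [nullRight_mul_nullLeft, sub_mul, mul_assoc, nullRight_mul_self]; simp

theorem nullCommutator_mul_nullLeft : nullCommutator Q * nullLeft Q = nullLeft Q := by
  rw [nullCommutator, sub_mul, nullLeft_mul_nullRight_mul_nullLeft, mul_assoc (nullRight Q),
    nullLeft_mul_self]; simp

theorem nullLeft_mul_nullCommutator : nullLeft Q * nullCommutator Q = -nullLeft Q := by
  rw [nullCommutator, mul_sub, ← mul_assoc, ← mul_assoc, nullLeft_mul_nullRight_mul_nullLeft,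
    nullLeft_mul_self]; simp

theorem nullCommutator_mul_nullRight : nullCommutator Q * nullRight Q = -nullRight Q := by
  rw [nullCommutator, sub_mul, nullRight_mul_nullLeft_mul_nullRight, mul_assoc (nullLeft Q),
    nullRight_mul_self]; simp

theorem nullRight_mul_nullCommutator : nullRight Q * nullCommutator Q = nullRight Q := by
  rw [nullCommutator, mul_sub, ← mul_assoc, ← mul_assoc, nullRight_mul_nullLeft_mul_nullRight,
    nullRight_mul_self]; simp

theorem nullCommutator_mul_self : nullCommutator Q * nullCommutator Q = 1 := by
  nth_rw 2 [nullCommutator]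
  rw [mul_sub, ← mul_assoc, ← mul_assoc, nullCommutator_mul_nullLeft, nullCommutator_mul_nullRight,
    neg_mul, nullRight_mul_nullLeft]
  abel

theorem nullCommutator_mul_ι (m : M) :
    nullCommutator Q * ι _ (m, 0, 0) = ι (addHyperbolic Q) (m, 0, 0) * nullCommutator Q := by
  simp only [nullCommutator, sub_mul, mul_sub, mul_assoc, nullLeft_mul_ι, nullRight_mul_ι, mul_neg]
  simp only [← mul_assoc, nullLeft_mul_ι, nullRight_mul_ι, neg_mul, neg_neg]

/-- The embedding of the Clifford algebra of `Q` into the centralizer of the Clifford algebra of the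
hyperbolic plane. -/
def toCentralizer : CliffordAlgebra Q →ₐ[R] CliffordAlgebra (addHyperbolic Q) :=
  lift _ ⟨LinearMap.mulRight R (nullCommutator Q) ∘ₗ ι (addHyperbolic Q) ∘ₗ LinearMap.inl R M (R × R),
    fun m => by
      change ι (addHyperbolic Q) (m, 0, 0) * nullCommutator Q *
        (ι (addHyperbolic Q) (m, 0, 0) * nullCommutator Q) = _
      rw [mul_assoc, ← mul_assoc (nullCommutator Q), nullCommutator_mul_ι, mul_assoc,
        nullCommutator_mul_self, mul_one, ι_sq_scalar]
      simp⟩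

theorem toCentralizer_ι (m : M) :
    toCentralizer Q (ι Q m) = ι (addHyperbolic Q) (m, 0, 0) * nullCommutator Q :=
  lift_ι_apply _ _ _

theorem commute_of_commute_ι {A : Type*} [Ring A] [Algebra R A] {f : CliffordAlgebra Q →ₐ[R] A}
    {a : A} (h : ∀ m, Commute a (f (ι Q m))) (x : CliffordAlgebra Q) : Commute a (f x) := by
  induction x using CliffordAlgebra.induction with
  | algebraMap r => rw [AlgHom.commutes]; exact Algebra.commute_algebraMap_right r a
  | ι m => exact h m
  | mul x y hx hy => rw [map_mul]; exact hx.mul_right hy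
  | add x y hx hy => rw [map_add]; exact hx.add_right hy

theorem nullLeft_commute (x : CliffordAlgebra Q) : Commute (nullLeft Q) (toCentralizer Q x) := by
  refine commute_of_commute_ι Q (fun m => ?_) x
  rw [Commute, SemiconjBy, toCentralizer_ι, ← mul_assoc, nullLeft_mul_ι, neg_mul, mul_assoc,
    nullLeft_mul_nullCommutator, mul_assoc, nullCommutator_mul_nullLeft, mul_neg, neg_neg]

theorem nullRight_commute (x : CliffordAlgebra Q) : Commute (nullRight Q) (toCentralizer Q x) := by
  refine commute_of_commute_ι Q (fun m => ?_) x
  rw [Commute, SemiconjBy, toCentralizer_ι, ← mul_assoc, nullRight_mul_ι, neg_mul, mul_assoc,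
    nullRight_mul_nullCommutator, mul_assoc, nullCommutator_mul_nullRight, mul_neg]

theorem toMatrix_nullLeft : toMatrix Q (nullLeft Q) = !![0, 1; 0, 0] := by
  simp [nullLeft, toMatrix_ι]

theorem toMatrix_nullRight : toMatrix Q (nullRight Q) = !![0, 0; 1, 0] := by
  simp [nullRight, toMatrix_ι]

theorem toMatrix_toCentralizer (x : CliffordAlgebra Q) :
    toMatrix Q (toCentralizer Q x) = !![x, 0; 0, x] := by
  induction x using CliffordAlgebra.induction with
  | algebraMap r =>
    rw [AlgHom.commutes, AlgHom.commutes]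
    ext i j
    fin_cases i <;> fin_cases j <;> simp [Matrix.algebraMap_matrix_apply]
  | ι m =>
    rw [toCentralizer_ι, nullCommutator, map_mul, map_sub, map_mul, map_mul, toMatrix_nullLeft,
      toMatrix_nullRight, toMatrix_ι]
    ext i j
    fin_cases i <;> fin_cases j <;> simp
  | mul x y hx hy => rw [map_mul, map_mul, hx, hy]; simp
  | add x y hx hy => rw [map_add, map_add, hx, hy]; simp

/-- The inverse of `CliffordAlgebra.toMatrix` as a linear map, sending matrix units to products of
null vectors. -/
def ofMatrixLinear :
    Matrix (Fin 2) (Fin 2) (CliffordAlgebra Q) →ₗ[R] CliffordAlgebra (addHyperbolic Q) where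
  toFun A := toCentralizer Q (A 0 0) * (nullLeft Q * nullRight Q) +
    toCentralizer Q (A 0 1) * nullLeft Q + toCentralizer Q (A 1 0) * nullRight Q +
    toCentralizer Q (A 1 1) * (nullRight Q * nullLeft Q)
  map_add' A B := by simp only [Matrix.add_apply, map_add, add_mul]; abel
  map_smul' r A := by simp [smul_add]

theorem ofMatrixLinear_apply (A : Matrix (Fin 2) (Fin 2) (CliffordAlgebra Q)) :
    ofMatrixLinear Q A = toCentralizer Q (A 0 0) * (nullLeft Q * nullRight Q) +
    toCentralizer Q (A 0 1) * nullLeft Q + toCentralizer Q (A 1 0) * nullRight Q +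
    toCentralizer Q (A 1 1) * (nullRight Q * nullLeft Q) := rfl

theorem toMatrix_ofMatrixLinear (A : Matrix (Fin 2) (Fin 2) (CliffordAlgebra Q)) :
    toMatrix Q (ofMatrixLinear Q A) = A := by
  simp only [ofMatrixLinear_apply, map_add, map_mul, toMatrix_toCentralizer, toMatrix_nullLeft,
    toMatrix_nullRight]
  ext i j
  fin_cases i <;> fin_cases j <;> simp

theorem ofMatrixLinear_one : ofMatrixLinear Q 1 = 1 := by
  simp [ofMatrixLinear_apply, nullRight_mul_nullLeft]

theorem ofMatrixLinear_mul (A B : Matrix (Fin 2) (Fin 2) (CliffordAlgebra Q)) :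
    ofMatrixLinear Q (A * B) = ofMatrixLinear Q A * ofMatrixLinear Q B := by
  have he' := fun x y => (nullLeft_commute Q x).left_comm y
  have hf' := fun x y => (nullRight_commute Q x).left_comm y
  have hee := nullLeft_mul_self Q
  have hff := nullRight_mul_self Q
  have hee' : ∀ y, nullLeft Q * (nullLeft Q * y) = 0 := fun y => by rw [← mul_assoc, hee, zero_mul]
  have hff' : ∀ y, nullRight Q * (nullRight Q * y) = 0 := fun y => by
    rw [← mul_assoc, hff, zero_mul]
  have hefe : nullLeft Q * (nullRight Q * nullLeft Q) = nullLeft Q := by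
    rw [← mul_assoc, nullLeft_mul_nullRight_mul_nullLeft]
  have hfef : nullRight Q * (nullLeft Q * nullRight Q) = nullRight Q := by
    rw [← mul_assoc, nullRight_mul_nullLeft_mul_nullRight]
  simp only [ofMatrixLinear_apply, Matrix.mul_apply, Fin.sum_univ_two, map_add, map_mul, add_mul,
    mul_add, mul_assoc, he', hf', hee, hff, hee', hff', hefe, hfef, mul_zero]
  abel

/-- Adding a hyperbolic plane to a quadratic form replaces its Clifford algebra by the algebra of
`2 × 2` matrices over it. -/
def equivMatrix :
    CliffordAlgebra (addHyperbolic Q) ≃ₐ[R] Matrix (Fin 2) (Fin 2) (CliffordAlgebra Q) :=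
  AlgEquiv.ofAlgHom (toMatrix Q)
    (AlgHom.ofLinearMap (ofMatrixLinear Q) (ofMatrixLinear_one Q) (ofMatrixLinear_mul Q))
    (AlgHom.ext (toMatrix_ofMatrixLinear Q))
    (hom_ext <| LinearMap.ext fun ⟨m, a, b⟩ => by
      have h : ((m, a, b) : M × R × R) = (m, 0, 0) + a • (0, 1, 0) + b • (0, 0, 1) := by simp
      change ofMatrixLinear Q (toMatrix Q (ι _ _)) = ι _ _
      rw [toMatrix_ι, ofMatrixLinear_apply]
      simp only [Matrix.of_apply, Matrix.cons_val', Matrix.cons_val_zero, Matrix.cons_val_one,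
        Matrix.cons_val_fin_one, AlgHom.commutes, map_neg, toCentralizer_ι]
      have hg : ι (addHyperbolic Q) (m, 0, 0) * nullCommutator Q * nullCommutator Q =
          ι (addHyperbolic Q) (m, 0, 0) := by rw [mul_assoc, nullCommutator_mul_self, mul_one]
      rw [h, map_add, map_add, map_smul, map_smul, ← nullLeft, ← nullRight, Algebra.smul_def,
        Algebra.smul_def]
      nth_rw 3 [← hg]
      nth_rw 4 [nullCommutator]
      noncomm_ring)

end Hyperbolic

end CliffordAlgebra

/-- Splitting off the first positive and the first negative coordinate as a hyperbolic plane. -/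
noncomputable def geomFormSuccIsometry (p q : ℕ) :
    (geomForm (p + 1) (q + 1)).IsometryEquiv (CliffordAlgebra.addHyperbolic (geomForm p q)) where
  toFun x := (fun i => x (Sum.map Fin.succ Fin.succ i),
    x (.inl 0) + x (.inr 0), x (.inl 0) - x (.inr 0))
  invFun y := Sum.elim (Fin.cons ((y.2.1 + y.2.2) / 2) fun i => y.1 (.inl i))
    (Fin.cons ((y.2.1 - y.2.2) / 2) fun i => y.1 (.inr i))
  map_add' x y := by
    ext <;> simp <;> ring
  map_smul' r x := by
    ext <;> simp <;> ring
  left_inv x := by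
    ext i
    rcases i with i | i <;> refine Fin.cases ?_ (fun i => ?_) i <;> simp
  right_inv y := by
    ext i
    · rcases i with i | i <;> simp
    · simp; ring
    · simp; ring
  map_app' x := by
    simp [geomForm, QuadraticMap.weightedSumSquares_apply, Fin.sum_univ_succ]
    ring

theorem stmt2 (p q k : ℕ) (hk : 1 ≤ k) :
    Nonempty (GeometricAlgebra (p + k) (q + k) ≃ₐ[ℝ]
      Matrix (Fin (2 ^ k)) (Fin (2 ^ k)) (GeometricAlgebra p q)) := by
  clear hk
  induction k with
  | zero => exact ⟨(Matrix.uniqueAlgEquiv (m := Unit)).symm.trans <|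
      Matrix.reindexAlgEquiv ℝ _ (Equiv.ofUnique Unit (Fin 1))⟩
  | succ k ih =>
    obtain ⟨e⟩ := ih
    exact ⟨(CliffordAlgebra.equivOfIsometry (geomFormSuccIsometry (p + k) (q + k))).trans <|
      (CliffordAlgebra.equivMatrix _).trans <| e.mapMatrix.trans <|
      (Matrix.compAlgEquiv (Fin 2) (Fin (2 ^ k)) _ ℝ).trans <|
      Matrix.reindexAlgEquiv ℝ _ (finProdFinEquiv.trans (finCongr (pow_succ' 2 k).symm))⟩
end

section
/- For all natural numbers p and q, the real geometric algebra 𝒢_{p+4,q} is isomorphic as an ℝ-algebra to the real geometric algebra 𝒢_{p,q+4}. -/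
/-- A family `a` in an algebra is a Clifford family with weights `c` if its members anticommute
pairwise and `a i` squares to the scalar `c i`. -/
structure IsCliffordFamily {I A : Type*} [Ring A] [Algebra ℝ A] (c : I → ℝ) (a : I → A) :
    Prop where
  sq : ∀ i, a i * a i = algebraMap ℝ A (c i)
  anti : ∀ i j, i ≠ j → a i * a j = -(a j * a i)

namespace IsCliffordFamily

section Lift

variable {I A : Type*} [Fintype I] [Ring A] [Algebra ℝ A]

theorem linearCombination_mul_self {c : I → ℝ} {a : I → A} (h : IsCliffordFamily c a)
    (x : I → ℝ) :
    Fintype.linearCombination ℝ a x * Fintype.linearCombination ℝ a x =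
      algebraMap ℝ A (QuadraticMap.weightedSumSquares ℝ c x) := by
  classical
  have hsymm : ∀ i j, a i * a j + a j * a i = if i = j then (2 * c i) • (1 : A) else 0 := by
    intro i j
    split_ifs with hij
    · subst hij
      rw [h.sq, Algebra.algebraMap_eq_smul_one, ← two_smul ℝ, smul_smul]
    · rw [h.anti i j hij, neg_add_cancel]
  have hdouble : (2 : ℝ) • (Fintype.linearCombination ℝ a x * Fintype.linearCombination ℝ a x) =
      (2 : ℝ) • algebraMap ℝ A (QuadraticMap.weightedSumSquares ℝ c x) := by
    have hexp : Fintype.linearCombination ℝ a x * Fintype.linearCombination ℝ a x =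
        ∑ i, ∑ j, (x i * x j) • (a i * a j) := by
      simp only [Fintype.linearCombination_apply, Finset.sum_mul_sum, smul_mul_smul_comm]
    have hexp' : Fintype.linearCombination ℝ a x * Fintype.linearCombination ℝ a x =
        ∑ i, ∑ j, (x i * x j) • (a j * a i) := by
      rw [hexp, Finset.sum_comm]
      simp only [mul_comm]
    rw [two_smul]
    conv_lhs => rw [hexp]
    conv_lhs => arg 2; rw [← hexp, hexp']
    simp only [← Finset.sum_add_distrib, ← smul_add, hsymm, smul_ite, smul_zero,
      Finset.sum_ite_eq, Finset.mem_univ, if_true]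
    rw [QuadraticMap.weightedSumSquares_apply, Algebra.algebraMap_eq_smul_one, Finset.sum_smul,
      Finset.smul_sum]
    refine Finset.sum_congr rfl fun i _ => ?_
    simp only [smul_smul, smul_eq_mul]
    congr 1
    ring
  exact smul_right_injective A (two_ne_zero (α := ℝ)) hdouble

/-- The algebra homomorphism out of the Clifford algebra of a diagonal form determined by a
Clifford family. -/
noncomputable def lift {c : I → ℝ} {a : I → A} (h : IsCliffordFamily c a) :
    CliffordAlgebra (QuadraticMap.weightedSumSquares ℝ c) →ₐ[ℝ] A :=
  CliffordAlgebra.lift _ ⟨Fintype.linearCombination ℝ a, h.linearCombination_mul_self⟩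

/-- The standard generators of the Clifford algebra of a diagonal form. -/
noncomputable def gen [DecidableEq I] (c : I → ℝ) (i : I) :
    CliffordAlgebra (QuadraticMap.weightedSumSquares ℝ c) :=
  CliffordAlgebra.ι _ (Pi.single i 1)

variable [DecidableEq I]

theorem lift_gen {c : I → ℝ} {a : I → A} (h : IsCliffordFamily c a) (i : I) :
    h.lift (gen c i) = a i := by
  simp [lift, gen, Fintype.linearCombination_apply_single]

theorem isCliffordFamily_gen (c : I → ℝ) : IsCliffordFamily c (gen c) where
  sq i := by
    rw [gen, CliffordAlgebra.ι_sq_scalar]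
    simp [QuadraticMap.weightedSumSquares_apply, Pi.single_apply]
  anti i j hij := by
    refine CliffordAlgebra.ι_mul_ι_comm_of_isOrtho ?_
    rw [QuadraticMap.isOrtho_def]
    simp only [QuadraticMap.weightedSumSquares_apply, Pi.add_apply, smul_eq_mul,
      ← Finset.sum_add_distrib]
    refine Finset.sum_congr rfl fun k _ => ?_
    rcases eq_or_ne k i with rfl | hk
    · simp [hij]
    · simp [hk]

theorem algHom_ext {c : I → ℝ}
    {f g : CliffordAlgebra (QuadraticMap.weightedSumSquares ℝ c) →ₐ[ℝ] A}
    (h : ∀ i, f (gen c i) = g (gen c i)) : f = g := by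
  refine CliffordAlgebra.hom_ext ((Pi.basisFun ℝ I).ext fun i => ?_)
  simpa [gen] using h i

end Lift

section Twist

variable {J A B : Type*} [Ring A] [Algebra ℝ A] [Ring B] [Algebra ℝ B]

/-- The product of the last four members of a family indexed by `J ⊕ Fin 4`. -/
def volumeElement (a : J ⊕ Fin 4 → A) : A :=
  a (.inr 0) * a (.inr 1) * a (.inr 2) * a (.inr 3)

/-- Multiply the last four members of a family on the right by their product. -/
def twist (a : J ⊕ Fin 4 → A) : J ⊕ Fin 4 → A :=
  Sum.elim (fun j => a (.inl j)) (fun k => a (.inr k) * volumeElement a)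

theorem map_twist (f : A →ₐ[ℝ] B) (a : J ⊕ Fin 4 → A) (i : J ⊕ Fin 4) :
    f (twist a i) = twist (fun i => f (a i)) i := by
  cases i <;> simp [twist, volumeElement]

variable {I : Type*} {c' : I → ℝ} {b : I → A} {c : J → ℝ} {s t : ℝ} {a : J ⊕ Fin 4 → A}

theorem mul_mul_eq_neg (h : IsCliffordFamily c' b) {i j : I} (hij : i ≠ j) (x : A) :
    b i * (b j * x) = -(b j * (b i * x)) := by
  rw [← mul_assoc, h.anti i j hij, neg_mul, mul_assoc]

theorem inl_mul_volumeElement (h : IsCliffordFamily (Sum.elim c fun _ => s) a) (j : J) :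
    a (.inl j) * volumeElement a = volumeElement a * a (.inl j) := by
  have hj : ∀ k, a (.inl j) * a (.inr k) = -(a (.inr k) * a (.inl j)) := fun k =>
    h.anti (.inl j) (.inr k) (by simp)
  have hj' : ∀ k x, a (.inl j) * (a (.inr k) * x) = -(a (.inr k) * (a (.inl j) * x)) :=
    fun k => h.mul_mul_eq_neg (by simp)
  simp only [volumeElement, mul_assoc, hj, hj', mul_neg, neg_neg]

theorem inr_mul_volumeElement (h : IsCliffordFamily (Sum.elim c fun _ => s) a) (k : Fin 4) :
    a (.inr k) * volumeElement a = -(volumeElement a * a (.inr k)) := by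
  have hlt : ∀ k l : Fin 4, k < l → a (.inr k) * a (.inr l) = -(a (.inr l) * a (.inr k)) :=
    fun k l hkl => h.anti _ _ (by simpa using hkl.ne)
  have hlt' : ∀ k l : Fin 4, k < l → ∀ x,
      a (.inr k) * (a (.inr l) * x) = -(a (.inr l) * (a (.inr k) * x)) :=
    fun k l hkl => h.mul_mul_eq_neg (by simpa using hkl.ne)
  fin_cases k <;>
    simp [volumeElement, mul_assoc, hlt 0 1, hlt 0 2, hlt 0 3,
      hlt' 0 1, hlt' 0 2, hlt' 0 3, hlt' 1 2, hlt' 1 3, hlt' 2 3]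

theorem volumeElement_mul_self (h : IsCliffordFamily (Sum.elim c fun _ => s) a)
    (hs : s * s = 1) : volumeElement a * volumeElement a = 1 := by
  have hlt : ∀ k l : Fin 4, k < l → ∀ x,
      a (.inr l) * (a (.inr k) * x) = -(a (.inr k) * (a (.inr l) * x)) :=
    fun k l hkl => h.mul_mul_eq_neg (by simpa using hkl.ne')
  have hsq : ∀ k, a (.inr k) * a (.inr k) = s • (1 : A) := fun k => by
    rw [h.sq, Algebra.algebraMap_eq_smul_one, Sum.elim_inr]
  simp [volumeElement, mul_assoc, hlt 0 1, hlt 0 2, hlt 0 3, hlt 1 2, hlt 1 3, hlt 2 3, hsq,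
    smul_smul, hs]

theorem mul_volumeElement_mul (h : IsCliffordFamily (Sum.elim c fun _ => s) a)
    (hs : s * s = 1) (x : A) (k : Fin 4) :
    x * volumeElement a * (a (.inr k) * volumeElement a) = -(x * a (.inr k)) := by
  rw [h.inr_mul_volumeElement, mul_neg, mul_assoc, ← mul_assoc (volumeElement a),
    h.volumeElement_mul_self hs, one_mul]

theorem twist_isCliffordFamily (h : IsCliffordFamily (Sum.elim c fun _ => s) a)
    (hs : s * s = 1) (hst : t = -s) :
    IsCliffordFamily (Sum.elim c fun _ => t) (twist a) where
  sq i := by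
    rcases i with j | k
    · exact h.sq (.inl j)
    · simp only [twist, Sum.elim_inr, hst, map_neg, h.mul_volumeElement_mul hs, h.sq]
  anti i j hij := by
    have ha := h.anti i j hij
    rcases i with i | i <;> rcases j with j | j <;> simp only [twist, Sum.elim_inr, Sum.elim_inl]
    · exact ha
    · rw [mul_assoc, ← h.inl_mul_volumeElement, ← mul_assoc, ha, neg_mul, mul_assoc]
    · rw [mul_assoc, ← h.inl_mul_volumeElement, ← mul_assoc, ha, neg_mul, mul_assoc]
    · rw [h.mul_volumeElement_mul hs, h.mul_volumeElement_mul hs, ha]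

theorem volumeElement_twist (h : IsCliffordFamily (Sum.elim c fun _ => s) a)
    (hs : s * s = 1) : volumeElement (twist a) = volumeElement a := by
  rw [volumeElement, mul_assoc (_ * _)]
  simp only [twist, Sum.elim_inr, h.mul_volumeElement_mul hs, neg_mul_neg]
  rw [volumeElement, mul_assoc (_ * _)]

theorem twist_twist (h : IsCliffordFamily (Sum.elim c fun _ => s) a) (hs : s * s = 1) :
    twist (twist a) = a := by
  funext i
  rcases i with j | k
  · rfl
  · rw [twist, Sum.elim_inr, h.volumeElement_twist hs, twist, Sum.elim_inr, mul_assoc,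
      h.volumeElement_mul_self hs, mul_one]

end Twist

section Equiv

variable {J : Type*} [Fintype J] [DecidableEq J] {c : J → ℝ} {s t : ℝ}

/-- The homomorphism reversing the sign of the last four weights, by twisting the generators. -/
noncomputable def twistHom (c : J → ℝ) (hs : s * s = 1) (hst : t = -s) :
    CliffordAlgebra (QuadraticMap.weightedSumSquares ℝ
      (Sum.elim c fun _ : Fin 4 => t)) →ₐ[ℝ]
    CliffordAlgebra (QuadraticMap.weightedSumSquares ℝ (Sum.elim c fun _ : Fin 4 => s)) :=
  ((isCliffordFamily_gen (Sum.elim c fun _ : Fin 4 => s)).twist_isCliffordFamily hs hst).lift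

theorem twistHom_comp_twistHom (hs : s * s = 1) (hst : t = -s) (ht : t * t = 1)
    (hts : s = -t) :
    (twistHom c hs hst).comp (twistHom c ht hts) = AlgHom.id ℝ _ := by
  refine algHom_ext fun i => ?_
  simp only [AlgHom.comp_apply, AlgHom.id_apply, twistHom, lift_gen, map_twist]
  exact congrFun ((isCliffordFamily_gen _).twist_twist hs) i

/-- Reversing the sign of four equal weights `±1` does not change the Clifford algebra. -/
noncomputable def twistEquiv (c : J → ℝ) :
    CliffordAlgebra (QuadraticMap.weightedSumSquares ℝ
      (Sum.elim c fun _ : Fin 4 => (1 : ℝ))) ≃ₐ[ℝ]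
    CliffordAlgebra (QuadraticMap.weightedSumSquares ℝ (Sum.elim c fun _ : Fin 4 => (-1 : ℝ))) :=
  AlgEquiv.ofAlgHom (twistHom c (by norm_num) (by norm_num))
    (twistHom c (by norm_num) (by norm_num))
    (twistHom_comp_twistHom _ _ _ _) (twistHom_comp_twistHom _ _ _ _)

end Equiv

end IsCliffordFamily

/-- Reindexing a diagonal form along a weight-preserving equivalence. -/
def weightedSumSquaresReindex {I I' : Type*} [Fintype I] [Fintype I'] (e : I ≃ I')
    (c : I → ℝ) (c' : I' → ℝ) (h : ∀ i, c' (e i) = c i) :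
    (QuadraticMap.weightedSumSquares ℝ c).IsometryEquiv
      (QuadraticMap.weightedSumSquares ℝ c') where
  toLinearEquiv := LinearEquiv.funCongrLeft ℝ ℝ e.symm
  map_app' x := by
    simp only [QuadraticMap.weightedSumSquares_apply]
    rw [← e.sum_comp]
    simp [LinearEquiv.funCongrLeft_apply, LinearMap.funLeft_apply, h]

/-- Move the last four indices of the first block to the end. -/
def splitFirst (p q : ℕ) : Fin (p + 4) ⊕ Fin q ≃ (Fin p ⊕ Fin q) ⊕ Fin 4 :=
  (Equiv.sumCongr finSumFinEquiv.symm (Equiv.refl _)).trans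
    ((Equiv.sumAssoc _ _ _).trans ((Equiv.sumCongr (Equiv.refl _) (Equiv.sumComm _ _)).trans
      (Equiv.sumAssoc _ _ _).symm))

/-- Regard the last four indices of the second block as a separate block. -/
def joinSecond (p q : ℕ) : (Fin p ⊕ Fin q) ⊕ Fin 4 ≃ Fin p ⊕ Fin (q + 4) :=
  (Equiv.sumAssoc _ _ _).trans (Equiv.sumCongr (Equiv.refl _) finSumFinEquiv)

theorem stmt3 (p q : ℕ) :
    Nonempty (GeometricAlgebra (p + 4) q ≃ₐ[ℝ] GeometricAlgebra p (q + 4)) := by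
  let c : Fin p ⊕ Fin q → ℝ := Sum.elim (fun _ => 1) (fun _ => -1)
  have hfirst : ∀ i, Sum.elim c (fun _ : Fin 4 => (1 : ℝ)) (splitFirst p q i) =
      Sum.elim (fun _ : Fin (p + 4) => (1 : ℝ)) (fun _ : Fin q => (-1 : ℝ)) i := by
    refine (splitFirst p q).symm.surjective.forall.2 ?_
    rintro ((i | i) | i) <;> simp [splitFirst, c]
  have hsecond : ∀ i, Sum.elim (fun _ : Fin p => (1 : ℝ)) (fun _ : Fin (q + 4) => (-1 : ℝ))
      (joinSecond p q i) = Sum.elim c (fun _ : Fin 4 => (-1 : ℝ)) i := by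
    rintro ((i | i) | i) <;> simp [joinSecond, c]
  exact ⟨(CliffordAlgebra.equivOfIsometry (weightedSumSquaresReindex _ _ _ hfirst)).trans
    ((IsCliffordFamily.twistEquiv c).trans
      (CliffordAlgebra.equivOfIsometry (weightedSumSquaresReindex _ _ _ hsecond)))⟩
end

section
/- The real geometric algebra 𝒢_{1,2} is isomorphic as an ℝ-algebra to the algebra M_2(ℂ) of 2 × 2 complex matrices. -/
lemma geomForm_one_two_apply (v : Fin 1 ⊕ Fin 2 → ℝ) :
    geomForm 1 2 v = v (.inl 0) * v (.inl 0) - v (.inr 0) * v (.inr 0)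
      - v (.inr 1) * v (.inr 1) := by
  simp [geomForm, QuadraticMap.weightedSumSquares_apply, Fin.sum_univ_two]
  ring

/-- The matrix representing a vector of `ℝ^{1,2}`. -/
noncomputable def vectorMatrix :
    (Fin 1 ⊕ Fin 2 → ℝ) →ₗ[ℝ] Matrix (Fin 2) (Fin 2) ℂ where
  toFun v := !![(v (.inl 0) : ℂ), ⟨v (.inr 0), v (.inr 1)⟩;
    ⟨-v (.inr 0), v (.inr 1)⟩, -(v (.inl 0) : ℂ)]
  map_add' v w := by
    ext i j
    fin_cases i <;> fin_cases j <;> simp [Complex.ext_iff, add_comm]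
  map_smul' r v := by
    ext i j
    fin_cases i <;> fin_cases j <;> simp [Complex.ext_iff]

lemma vectorMatrix_apply (v : Fin 1 ⊕ Fin 2 → ℝ) :
    vectorMatrix v = !![(v (.inl 0) : ℂ), ⟨v (.inr 0), v (.inr 1)⟩;
      ⟨-v (.inr 0), v (.inr 1)⟩, -(v (.inl 0) : ℂ)] := rfl

lemma vectorMatrix_mul_self (v : Fin 1 ⊕ Fin 2 → ℝ) :
    vectorMatrix v * vectorMatrix v = algebraMap ℝ _ (geomForm 1 2 v) := by
  rw [geomForm_one_two_apply, vectorMatrix_apply]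
  ext i j
  fin_cases i <;> fin_cases j <;>
    simp [Complex.ext_iff, Matrix.mul_apply, Matrix.algebraMap_matrix_apply] <;>
    (try constructor) <;> ring

/-- The representation of `𝒢_{1,2}` on `ℂ²`. -/
noncomputable def toMatrix : GeometricAlgebra 1 2 →ₐ[ℝ] Matrix (Fin 2) (Fin 2) ℂ :=
  CliffordAlgebra.lift _ ⟨vectorMatrix, vectorMatrix_mul_self⟩

lemma toMatrix_ι (v : Fin 1 ⊕ Fin 2 → ℝ) :
    toMatrix (CliffordAlgebra.ι _ v) = vectorMatrix v :=
  CliffordAlgebra.lift_ι_apply _ _ _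

section OfMatrix

variable {A : Type*} [Ring A] [Algebra ℝ A]

/-- The linear map sending a complex matrix to the corresponding combination of products of
`a`, `b`, `c`, where `a * b * c` plays the role of the imaginary unit. -/
noncomputable def ofMatrix (a b c : A) : Matrix (Fin 2) (Fin 2) ℂ →ₗ[ℝ] A where
  toFun M :=
    (((M 0 0).re + (M 1 1).re) / 2) • (1 : A) + (((M 0 0).re - (M 1 1).re) / 2) • a
    + (((M 0 1).re + (M 1 0).re) / 2) • (a * b) + (((M 0 1).re - (M 1 0).re) / 2) • b
    + (((M 0 0).im + (M 1 1).im) / 2) • (a * (b * c))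
    + (((M 0 0).im - (M 1 1).im) / 2) • (b * c)
    + (((M 0 1).im + (M 1 0).im) / 2) • c + (((M 0 1).im - (M 1 0).im) / 2) • (a * c)
  map_add' M N := by
    simp only [Matrix.add_apply, Complex.add_re, Complex.add_im]
    module
  map_smul' r M := by
    simp only [Matrix.smul_apply, Complex.smul_re, Complex.smul_im, smul_eq_mul, RingHom.id_apply]
    module

lemma ofMatrix_apply (a b c : A) (M : Matrix (Fin 2) (Fin 2) ℂ) :
    ofMatrix a b c M =
    (((M 0 0).re + (M 1 1).re) / 2) • (1 : A) + (((M 0 0).re - (M 1 1).re) / 2) • a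
    + (((M 0 1).re + (M 1 0).re) / 2) • (a * b) + (((M 0 1).re - (M 1 0).re) / 2) • b
    + (((M 0 0).im + (M 1 1).im) / 2) • (a * (b * c))
    + (((M 0 0).im - (M 1 1).im) / 2) • (b * c)
    + (((M 0 1).im + (M 1 0).im) / 2) • c
    + (((M 0 1).im - (M 1 0).im) / 2) • (a * c) := rfl

lemma ofMatrix_one (a b c : A) : ofMatrix a b c 1 = 1 := by
  simp [ofMatrix_apply]

lemma ofMatrix_vectorMatrix_mul {a b c : A} (haa : a * a = 1) (hbb : b * b = -1)
    (hcc : c * c = -1) (hba : b * a = -(a * b)) (hca : c * a = -(a * c))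
    (hcb : c * b = -(b * c)) (v : Fin 1 ⊕ Fin 2 → ℝ) (M : Matrix (Fin 2) (Fin 2) ℂ) :
    ofMatrix a b c (vectorMatrix v * M) =
      (v (.inl 0) • a + v (.inr 0) • b + v (.inr 1) • c) * ofMatrix a b c M := by
  have haa' (x : A) : a * (a * x) = x := by rw [← mul_assoc, haa, one_mul]
  have hbb' (x : A) : b * (b * x) = -x := by rw [← mul_assoc, hbb, neg_one_mul]
  have hba' (x : A) : b * (a * x) = -(a * (b * x)) := by
    rw [← mul_assoc, hba, neg_mul, mul_assoc]
  have hca' (x : A) : c * (a * x) = -(a * (c * x)) := by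
    rw [← mul_assoc, hca, neg_mul, mul_assoc]
  have hcb' (x : A) : c * (b * x) = -(b * (c * x)) := by
    rw [← mul_assoc, hcb, neg_mul, mul_assoc]
  simp only [ofMatrix_apply, vectorMatrix_apply, Matrix.mul_apply, Fin.sum_univ_two, mul_add,
    add_mul, smul_mul_assoc, mul_smul_comm, haa, hbb, hcc, hba, hca, hcb, haa', hbb', hba', hca',
    hcb', mul_one, mul_neg, neg_neg, Matrix.of_apply, Matrix.cons_val_zero, Matrix.cons_val_one,
    Matrix.cons_val', Matrix.cons_val_fin_one, Complex.add_re, Complex.add_im, Complex.mul_re,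
    Complex.mul_im, Complex.neg_re, Complex.neg_im, Complex.ofReal_re, Complex.ofReal_im]
  module

end OfMatrix

/-- The inverse of `toMatrix`, as a linear map. -/
noncomputable def fromMatrix : Matrix (Fin 2) (Fin 2) ℂ →ₗ[ℝ] GeometricAlgebra 1 2 :=
  ofMatrix (CliffordAlgebra.ι _ (Pi.single (.inl 0) 1))
    (CliffordAlgebra.ι _ (Pi.single (.inr 0) 1)) (CliffordAlgebra.ι _ (Pi.single (.inr 1) 1))

lemma toMatrix_fromMatrix (M : Matrix (Fin 2) (Fin 2) ℂ) : toMatrix (fromMatrix M) = M := by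
  simp only [fromMatrix, ofMatrix_apply, map_add, map_smul, map_mul, map_one, toMatrix_ι,
    vectorMatrix_apply]
  ext i j
  fin_cases i <;> fin_cases j <;>
    simp [Complex.ext_iff] <;>
    constructor <;> ring

lemma ι_mul_ι_self (i : Fin 1 ⊕ Fin 2) :
    CliffordAlgebra.ι (geomForm 1 2) (Pi.single i 1) * CliffordAlgebra.ι _ (Pi.single i 1) =
      algebraMap ℝ _ (Sum.elim (fun _ => 1) (fun _ => -1) i) := by
  rw [CliffordAlgebra.ι_sq_scalar, geomForm_one_two_apply]
  congr 1
  rcases i with i | i <;> fin_cases i <;> simp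

lemma ι_mul_ι_of_ne {i j : Fin 1 ⊕ Fin 2} (h : i ≠ j) :
    CliffordAlgebra.ι (geomForm 1 2) (Pi.single i 1) * CliffordAlgebra.ι _ (Pi.single j 1) =
      -(CliffordAlgebra.ι _ (Pi.single j 1) * CliffordAlgebra.ι _ (Pi.single i 1)) := by
  apply CliffordAlgebra.ι_mul_ι_comm_of_isOrtho
  rw [QuadraticMap.isOrtho_def]
  simp only [geomForm_one_two_apply, Pi.add_apply]
  rcases i with i | i <;> rcases j with j | j <;> fin_cases i <;> fin_cases j <;> simp [sub_eq_add_neg] at h ⊢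

lemma fromMatrix_vectorMatrix_mul (v : Fin 1 ⊕ Fin 2 → ℝ) (M : Matrix (Fin 2) (Fin 2) ℂ) :
    fromMatrix (vectorMatrix v * M) = CliffordAlgebra.ι _ v * fromMatrix M := by
  rw [fromMatrix, ofMatrix_vectorMatrix_mul ((ι_mul_ι_self _).trans (by simp))
    ((ι_mul_ι_self _).trans (by simp)) ((ι_mul_ι_self _).trans (by simp))
    (ι_mul_ι_of_ne (by simp)) (ι_mul_ι_of_ne (by simp))
    (ι_mul_ι_of_ne (by simp))]
  congr 1
  simp only [← map_smul, ← map_add]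
  congr 1
  ext i
  rcases i with i | i <;> fin_cases i <;> simp

lemma fromMatrix_toMatrix_mul (x : GeometricAlgebra 1 2) (M : Matrix (Fin 2) (Fin 2) ℂ) :
    fromMatrix (toMatrix x * M) = x * fromMatrix M := by
  induction x using CliffordAlgebra.induction generalizing M with
  | algebraMap r => simp only [AlgHom.commutes, ← Algebra.smul_def, map_smul]
  | ι v => rw [toMatrix_ι, fromMatrix_vectorMatrix_mul]
  | mul x y hx hy => rw [map_mul toMatrix, mul_assoc, hx, hy, mul_assoc]
  | add x y hx hy => rw [map_add, add_mul, map_add, hx, hy, add_mul]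

lemma fromMatrix_toMatrix (x : GeometricAlgebra 1 2) : fromMatrix (toMatrix x) = x := by
  have h := fromMatrix_toMatrix_mul x 1
  rwa [mul_one, fromMatrix, ofMatrix_one, mul_one] at h

theorem stmt5 :
    Nonempty (GeometricAlgebra 1 2 ≃ₐ[ℝ] Matrix (Fin 2) (Fin 2) ℂ) := by
  exact ⟨AlgEquiv.ofBijective toMatrix
    ⟨Function.LeftInverse.injective fromMatrix_toMatrix,
      Function.RightInverse.surjective toMatrix_fromMatrix⟩⟩
end

section
/- The real geometric algebra 𝒢_{0,3} is isomorphic as an ℝ-algebra to the product algebra ℍ × ℍ (the double quaternions ²ℍ). -/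
/-- An algebra homomorphism `h : A → B` and an idempotent `p` of `B` commuting with the range of
`h` induce the homomorphism `(x, y) ↦ h x * p + h y * (1 - p)` on `A × A`. -/
def AlgHom.prodOfIdempotent {R A B : Type*} [CommRing R] [Ring A] [Ring B] [Algebra R A]
    [Algebra R B] (h : A →ₐ[R] B) (p : B) (hp : p * p = p) (hc : ∀ x, p * h x = h x * p) :
    A × A →ₐ[R] B :=
  AlgHom.ofLinearMap
    ((LinearMap.mulRight R p ∘ₗ h.toLinearMap).coprod
      (LinearMap.mulRight R (1 - p) ∘ₗ h.toLinearMap))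
    (by simp)
    (by
      rintro ⟨x, y⟩ ⟨x', y'⟩
      have hp' : (1 - p) * (1 - p) = 1 - p := (IsIdempotentElem.one_sub hp)
      have h₁ : p * (1 - p) = 0 := by simp [mul_sub, hp]
      have h₂ : (1 - p) * p = 0 := by simp [sub_mul, hp]
      have hc' : ∀ x, (1 - p) * h x = h x * (1 - p) := fun x => by simp [mul_sub, sub_mul, hc]
      have key : ∀ (u v : A) (s t : B), s * h v = h v * s →
          h u * s * (h v * t) = h u * h v * (s * t) := fun u v s t hs => by
        rw [mul_assoc, ← mul_assoc s, hs]; simp only [mul_assoc]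
      simp [mul_add, add_mul, key, hc, hc', hp, hp', h₁, h₂])

theorem AlgHom.prodOfIdempotent_apply {R A B : Type*} [CommRing R] [Ring A] [Ring B] [Algebra R A]
    [Algebra R B] (h : A →ₐ[R] B) (p : B) (hp : p * p = p) (hc : ∀ x, p * h x = h x * p)
    (x : A × A) : h.prodOfIdempotent p hp hc x = h x.1 * p + h x.2 * (1 - p) :=
  rfl

namespace GeometricAlgebra

theorem geomForm_zero_three (m : Fin 0 ⊕ Fin 3 → ℝ) :
    geomForm 0 3 m =
      -(m (.inr 0) * m (.inr 0) + m (.inr 1) * m (.inr 1) + m (.inr 2) * m (.inr 2)) := by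
  simp [geomForm, QuadraticMap.weightedSumSquares_apply, Fin.sum_univ_three]

/-- A vector of `ℝ^{0+3}`, viewed as a purely imaginary quaternion. -/
noncomputable def toImaginary : (Fin 0 ⊕ Fin 3 → ℝ) →ₗ[ℝ] Quaternion ℝ where
  toFun m := ⟨0, m (.inr 0), m (.inr 1), m (.inr 2)⟩
  map_add' _ _ := Quaternion.ext _ _ (add_zero (0 : ℝ)).symm rfl rfl rfl
  map_smul' r _ := Quaternion.ext _ _ (mul_zero r).symm rfl rfl rfl

@[simp]
theorem re_toImaginary (m : Fin 0 ⊕ Fin 3 → ℝ) : (toImaginary m).re = 0 := rfl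

@[simp]
theorem imI_toImaginary (m : Fin 0 ⊕ Fin 3 → ℝ) : (toImaginary m).imI = m (.inr 0) := rfl

@[simp]
theorem imJ_toImaginary (m : Fin 0 ⊕ Fin 3 → ℝ) : (toImaginary m).imJ = m (.inr 1) := rfl

@[simp]
theorem imK_toImaginary (m : Fin 0 ⊕ Fin 3 → ℝ) : (toImaginary m).imK = m (.inr 2) := rfl

theorem toImaginary_mul_self (m : Fin 0 ⊕ Fin 3 → ℝ) :
    toImaginary m * toImaginary m = algebraMap ℝ _ (geomForm 0 3 m) := by
  rw [geomForm_zero_three]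
  apply Quaternion.ext <;> simp <;> ring

/-- The homomorphism `𝒢_{0,3} → ℍ × ℍ` sending a vector `v` to `(v, -v)`. -/
noncomputable def toDoubleQuaternion :
    GeometricAlgebra 0 3 →ₐ[ℝ] Quaternion ℝ × Quaternion ℝ :=
  CliffordAlgebra.lift (geomForm 0 3) ⟨toImaginary.prod (-toImaginary), fun m => by
    ext1 <;> simp [toImaginary_mul_self, Prod.algebraMap_apply]⟩

/-- The standard generators of `𝒢_{0,3}`. -/
noncomputable def gen (i : Fin 3) : GeometricAlgebra 0 3 :=
  CliffordAlgebra.ι (geomForm 0 3) (Pi.single (.inr i) 1)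

theorem gen_mul_self (i : Fin 3) : gen i * gen i = -1 := by
  rw [gen, CliffordAlgebra.ι_sq_scalar, geomForm_zero_three]
  fin_cases i <;> simp

theorem gen_mul_gen {i j : Fin 3} (h : j < i) : gen i * gen j = -(gen j * gen i) := by
  refine CliffordAlgebra.ι_mul_ι_comm_of_isOrtho ?_
  rw [QuadraticMap.isOrtho_def]
  simp only [geomForm_zero_three]
  fin_cases i <;> fin_cases j <;> simp at h ⊢

theorem gen_mul_self_mul (i : Fin 3) (x : GeometricAlgebra 0 3) :
    gen i * (gen i * x) = -x := by
  rw [← mul_assoc, gen_mul_self, neg_one_mul]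

theorem gen_mul_gen_mul {i j : Fin 3} (h : j < i) (x : GeometricAlgebra 0 3) :
    gen i * (gen j * x) = -(gen j * (gen i * x)) := by
  rw [← mul_assoc, gen_mul_gen h, neg_mul, mul_assoc]

/-- The even subalgebra of `𝒢_{0,3}` as a copy of the quaternions. -/
noncomputable def evenBasis : QuaternionAlgebra.Basis (GeometricAlgebra 0 3) (-1 : ℝ) 0 (-1) where
  i := gen 1 * gen 2
  j := -(gen 0 * gen 2)
  k := gen 0 * gen 1
  i_mul_i := by simp [mul_assoc, gen_mul_self, gen_mul_gen_mul]
  j_mul_j := by simp [mul_assoc, gen_mul_self, gen_mul_gen_mul]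
  i_mul_j := by simp [mul_assoc, gen_mul_self, gen_mul_gen, gen_mul_gen_mul]
  j_mul_i := by simp [mul_assoc, gen_mul_self, gen_mul_gen_mul]

/-- The embedding of the quaternions as the even subalgebra of `𝒢_{0,3}`. -/
noncomputable def ofQuaternion : Quaternion ℝ →ₐ[ℝ] GeometricAlgebra 0 3 :=
  evenBasis.liftHom

theorem ofQuaternion_apply (q : Quaternion ℝ) :
    ofQuaternion q = algebraMap ℝ _ q.re + q.imI • (gen 1 * gen 2) +
      q.imJ • (-(gen 0 * gen 2)) + q.imK • (gen 0 * gen 1) :=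
  rfl

/-- The pseudoscalar of `𝒢_{0,3}`. -/
noncomputable def pseudoscalar : GeometricAlgebra 0 3 :=
  gen 0 * (gen 1 * gen 2)

theorem pseudoscalar_mul_self : pseudoscalar * pseudoscalar = 1 := by
  simp [pseudoscalar, mul_assoc, gen_mul_self, gen_mul_gen_mul]

theorem pseudoscalar_mul_ofQuaternion (q : Quaternion ℝ) :
    pseudoscalar * ofQuaternion q = ofQuaternion q * pseudoscalar := by
  simp [ofQuaternion_apply, pseudoscalar, mul_add, add_mul, Algebra.algebraMap_eq_smul_one,
    mul_assoc, gen_mul_self, gen_mul_gen, gen_mul_self_mul, gen_mul_gen_mul]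

/-- The homomorphism `ℍ × ℍ → 𝒢_{0,3}` given by the central idempotent `(1 - ω) / 2`, with `ω` the
pseudoscalar. -/
noncomputable def ofDoubleQuaternion :
    Quaternion ℝ × Quaternion ℝ →ₐ[ℝ] GeometricAlgebra 0 3 :=
  ofQuaternion.prodOfIdempotent ((1 / 2 : ℝ) • (1 - pseudoscalar))
    (by
      simp only [smul_mul_smul_comm, mul_sub, sub_mul, one_mul, mul_one, pseudoscalar_mul_self]
      module)
    (fun x => by simp [mul_sub, sub_mul, pseudoscalar_mul_ofQuaternion])

theorem toDoubleQuaternion_gen (i : Fin 3) :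
    toDoubleQuaternion (gen i) =
      (toImaginary (Pi.single (.inr i) 1), -toImaginary (Pi.single (.inr i) 1)) := by
  exact CliffordAlgebra.lift_ι_apply _ _ _

theorem toDoubleQuaternion_pseudoscalar : toDoubleQuaternion pseudoscalar = (-1, 1) := by
  simp only [pseudoscalar, map_mul, toDoubleQuaternion_gen]
  refine Prod.ext (Quaternion.ext _ _ ?_ ?_ ?_ ?_) (Quaternion.ext _ _ ?_ ?_ ?_ ?_) <;>
    simp [Quaternion.re_one, Quaternion.imI_one, Quaternion.imJ_one, Quaternion.imK_one]

theorem toDoubleQuaternion_ofQuaternion (q : Quaternion ℝ) :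
    toDoubleQuaternion (ofQuaternion q) = (q, q) := by
  simp only [ofQuaternion_apply, map_add, map_mul, map_smul, map_neg, toDoubleQuaternion_gen,
    AlgHom.commutes, Prod.algebraMap_apply]
  refine Prod.ext (Quaternion.ext _ _ ?_ ?_ ?_ ?_) (Quaternion.ext _ _ ?_ ?_ ?_ ?_) <;> simp

theorem toDoubleQuaternion_ofDoubleQuaternion (x : Quaternion ℝ × Quaternion ℝ) :
    toDoubleQuaternion (ofDoubleQuaternion x) = x := by
  have h : (1 / 2 : ℝ) • (1 - (-1, 1) : Quaternion ℝ × Quaternion ℝ) = (1, 0) := by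
    refine Prod.ext ?_ ?_
    · change (1 / 2 : ℝ) • (1 - -1 : Quaternion ℝ) = 1
      module
    · change (1 / 2 : ℝ) • (1 - 1 : Quaternion ℝ) = 0
      module
  simp only [ofDoubleQuaternion, AlgHom.prodOfIdempotent_apply, map_add, map_mul, map_sub, map_smul,
    map_one, toDoubleQuaternion_ofQuaternion, toDoubleQuaternion_pseudoscalar, h]
  ext1 <;> simp

theorem ofDoubleQuaternion_toDoubleQuaternion_gen (i : Fin 3) :
    ofDoubleQuaternion (toDoubleQuaternion (gen i)) = gen i := by
  rw [toDoubleQuaternion_gen, ofDoubleQuaternion, AlgHom.prodOfIdempotent_apply]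
  fin_cases i <;>
    simp [ofQuaternion_apply, pseudoscalar, mul_sub, mul_assoc, gen_mul_self,
      gen_mul_self_mul, gen_mul_gen_mul] <;>
    module

/-- `𝒢_{0,3}` is isomorphic to the double quaternions. -/
noncomputable def equivDoubleQuaternion :
    GeometricAlgebra 0 3 ≃ₐ[ℝ] Quaternion ℝ × Quaternion ℝ :=
  AlgEquiv.ofAlgHom toDoubleQuaternion ofDoubleQuaternion
    (AlgHom.ext toDoubleQuaternion_ofDoubleQuaternion)
    (by
      refine CliffordAlgebra.hom_ext (LinearMap.pi_ext' fun i => LinearMap.ext_ring ?_)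
      rcases i with i | i
      · exact i.elim0
      · exact ofDoubleQuaternion_toDoubleQuaternion_gen i)

end GeometricAlgebra

theorem stmt8 :
    Nonempty (GeometricAlgebra 0 3 ≃ₐ[ℝ] (Quaternion ℝ × Quaternion ℝ)) :=
  ⟨GeometricAlgebra.equivDoubleQuaternion⟩
end

section
/- For every natural number p, the real geometric algebra 𝒢_{p,p} of neutral signature is isomorphic as an ℝ-algebra to the algebra M_{2^p}(ℝ) of 2^p × 2^p real matrices. -/
/-- Extending a Clifford map `f : V → A` by a hyperbolic plane gives a Clifford map into the
two-by-two matrices over `A`. -/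
def hyperbolicExtension {p q : ℕ} {A : Type*} [Ring A] [Algebra ℝ A]
    (f : ((Fin p ⊕ Fin q) → ℝ) →ₗ[ℝ] A) :
    ((Fin (p + 1) ⊕ Fin (q + 1)) → ℝ) →ₗ[ℝ] Matrix (Fin 2) (Fin 2) A where
  toFun v :=
    !![f (v ∘ Sum.map Fin.succ Fin.succ), algebraMap ℝ A (v (.inl 0) + v (.inr 0));
      algebraMap ℝ A (v (.inl 0) - v (.inr 0)), -f (v ∘ Sum.map Fin.succ Fin.succ)]
  map_add' v w := by
    have h : (v + w) ∘ Sum.map Fin.succ Fin.succ =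
      v ∘ Sum.map Fin.succ Fin.succ + w ∘ Sum.map (Fin.succ (n := p)) (Fin.succ (n := q)) := rfl
    ext i j
    fin_cases i <;> fin_cases j <;> simp [h] <;> abel
  map_smul' r v := by
    have h : (r • v) ∘ Sum.map Fin.succ Fin.succ =
      r • v ∘ Sum.map (Fin.succ (n := p)) (Fin.succ (n := q)) := rfl
    ext i j
    fin_cases i <;> fin_cases j <;> simp [h, ← Algebra.smul_def, smul_add, smul_sub]

theorem hyperbolicExtension_apply {p q : ℕ} {A : Type*} [Ring A] [Algebra ℝ A]
    (f : ((Fin p ⊕ Fin q) → ℝ) →ₗ[ℝ] A) (v : (Fin (p + 1) ⊕ Fin (q + 1)) → ℝ) :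
    hyperbolicExtension f v =
      !![f (v ∘ Sum.map Fin.succ Fin.succ), algebraMap ℝ A (v (.inl 0) + v (.inr 0));
        algebraMap ℝ A (v (.inl 0) - v (.inr 0)), -f (v ∘ Sum.map Fin.succ Fin.succ)] :=
  rfl

theorem geomForm_succ_succ {p q : ℕ} (v : (Fin (p + 1) ⊕ Fin (q + 1)) → ℝ) :
    geomForm (p + 1) (q + 1) v =
      geomForm p q (v ∘ Sum.map Fin.succ Fin.succ) +
        (v (.inl 0) + v (.inr 0)) * (v (.inl 0) - v (.inr 0)) := by
  simp [geomForm, QuadraticMap.weightedSumSquares_apply, Fin.sum_univ_succ]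
  ring

theorem hyperbolicExtension_mul_self {p q : ℕ} {A : Type*} [Ring A] [Algebra ℝ A]
    (f : ((Fin p ⊕ Fin q) → ℝ) →ₗ[ℝ] A)
    (hf : ∀ v, f v * f v = algebraMap ℝ A (geomForm p q v))
    (v : (Fin (p + 1) ⊕ Fin (q + 1)) → ℝ) :
    hyperbolicExtension f v * hyperbolicExtension f v =
      algebraMap ℝ (Matrix (Fin 2) (Fin 2) A) (geomForm (p + 1) (q + 1) v) := by
  rw [geomForm_succ_succ, hyperbolicExtension_apply]
  ext i j
  fin_cases i <;> fin_cases j <;>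
    simp [-map_add, -map_sub, Matrix.mul_apply, Matrix.algebraMap_matrix_apply, hf]
  · simp only [map_add, map_mul]
  · simp [Algebra.commutes _ (f _), -map_add]
  · simp [Algebra.commutes _ (f _), -map_sub]
  · rw [← map_mul, ← map_add, mul_comm, add_comm]

/-- If `g` is a surjection from the Clifford algebra of signature `(p, q)` onto `A`, then
signature `(p + 1, q + 1)` surjects onto the two-by-two matrices over `A`. -/
theorem exists_surjective_matrix_two {p q : ℕ} {A : Type*} [Ring A] [Algebra ℝ A]
    (g : GeometricAlgebra p q →ₐ[ℝ] A) (hg : Function.Surjective g) :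
    ∃ h : GeometricAlgebra (p + 1) (q + 1) →ₐ[ℝ] Matrix (Fin 2) (Fin 2) A,
      Function.Surjective h := by
  let f : ((Fin p ⊕ Fin q) → ℝ) →ₗ[ℝ] A := g.toLinearMap ∘ₗ CliffordAlgebra.ι (geomForm p q)
  have hf (v) : f v * f v = algebraMap ℝ A (geomForm p q v) :=
    CliffordAlgebra.comp_ι_sq_scalar g v
  let h := CliffordAlgebra.lift (geomForm (p + 1) (q + 1))
    ⟨hyperbolicExtension f, hyperbolicExtension_mul_self f hf⟩
  have mem (v) : hyperbolicExtension f v ∈ h.range :=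
    ⟨CliffordAlgebra.ι _ v, CliffordAlgebra.lift_ι_apply _ _ _⟩
  have upper : Matrix.single 0 1 1 ∈ h.range := by
    convert mem (Sum.elim (Pi.single 0 (1 / 2)) (Pi.single 0 (1 / 2))) using 1
    have h0 : Sum.elim (Pi.single 0 (1 / 2)) (Pi.single 0 (1 / 2)) ∘
        Sum.map (Fin.succ (n := p)) (Fin.succ (n := q)) = (0 : Fin p ⊕ Fin q → ℝ) := by
      ext (i | i) <;> simp
    rw [hyperbolicExtension_apply, h0]
    ext i j
    fin_cases i <;> fin_cases j <;> simp [-map_add, -map_sub]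
    norm_num
  have lower : Matrix.single 1 0 1 ∈ h.range := by
    convert mem (Sum.elim (Pi.single 0 (1 / 2)) (Pi.single 0 (-1 / 2))) using 1
    have h0 : Sum.elim (Pi.single 0 (1 / 2)) (Pi.single 0 (-1 / 2)) ∘
        Sum.map (Fin.succ (n := p)) (Fin.succ (n := q)) = (0 : Fin p ⊕ Fin q → ℝ) := by
      ext (i | i) <;> simp
    rw [hyperbolicExtension_apply, h0]
    ext i j
    fin_cases i <;> fin_cases j <;> simp [-map_add, -map_sub] <;> norm_num
  have unit_mem (i j : Fin 2) : Matrix.single i j (1 : A) ∈ h.range := by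
    fin_cases i <;> fin_cases j
    · simpa using mul_mem upper lower
    · exact upper
    · exact lower
    · simpa using mul_mem lower upper
  have ι_mem (v) (i j : Fin 2) : Matrix.single i j (f v) ∈ h.range := by
    let w : (Fin (p + 1) ⊕ Fin (q + 1)) → ℝ :=
      Sum.elim (Fin.cons 0 (v ∘ .inl)) (Fin.cons 0 (v ∘ .inr))
    have hw : w ∘ Sum.map Fin.succ Fin.succ = v := by
      ext (i | i) <;> simp [w]
    have key := mul_mem (mem w) (unit_mem i j)
    rw [hyperbolicExtension_apply, hw] at key
    simp only [w, Sum.elim_inl, Sum.elim_inr, Fin.cons_zero, add_zero, sub_zero, map_zero] at key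
    fin_cases i
    · convert key using 1
      ext k l
      rw [Matrix.mul_apply]
      fin_cases k <;> simp [Matrix.single_apply]
    · convert neg_mem key using 1
      ext k l
      rw [Matrix.neg_apply, Matrix.mul_apply]
      fin_cases k <;> simp [Matrix.single_apply]
      split_ifs <;> simp
  have single_mem (x : GeometricAlgebra p q) (i j : Fin 2) :
      Matrix.single i j (g x) ∈ h.range := by
    induction x using CliffordAlgebra.induction generalizing i j with
    | algebraMap r =>
      convert h.range.smul_mem (unit_mem i j) r using 1
      rw [Matrix.smul_single, AlgHom.commutes, Algebra.algebraMap_eq_smul_one]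
    | ι v => exact ι_mem v i j
    | mul a b ha hb => simpa using mul_mem (ha i i) (hb i j)
    | add a b ha hb => simpa [Matrix.single_add] using add_mem (ha i j) (hb i j)
  refine ⟨h, fun M => ?_⟩
  change M ∈ h.range
  rw [Matrix.matrix_eq_sum_single M]
  refine sum_mem fun i _ => sum_mem fun j _ => ?_
  obtain ⟨x, hx⟩ := hg (M i j)
  exact hx ▸ single_mem x i j

theorem exists_surjective_matrix_pow_two (p : ℕ) :
    ∃ g : GeometricAlgebra p p →ₐ[ℝ] Matrix (Fin (2 ^ p)) (Fin (2 ^ p)) ℝ,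
      Function.Surjective g := by
  induction p with
  | zero =>
    refine ⟨CliffordAlgebra.lift _ ⟨0, fun v => ?_⟩, fun M => ⟨algebraMap ℝ _ (M 0 0), ?_⟩⟩
    · simp [geomForm, QuadraticMap.weightedSumSquares_apply]
    · ext i j
      obtain rfl : i = 0 := Subsingleton.elim (α := Fin 1) _ _
      obtain rfl : j = 0 := Subsingleton.elim (α := Fin 1) _ _
      rw [AlgHom.commutes, Matrix.algebraMap_matrix_apply]
      simp
  | succ p ih =>
    obtain ⟨g, hg⟩ := ih
    obtain ⟨h, hh⟩ := exists_surjective_matrix_two g hg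
    let e := (Matrix.compAlgEquiv (Fin 2) (Fin (2 ^ p)) ℝ ℝ).trans
      (Matrix.reindexAlgEquiv ℝ ℝ (finProdFinEquiv.trans (finCongr (pow_succ' 2 p).symm)))
    exact ⟨e.toAlgHom.comp h, e.surjective.comp hh⟩

theorem stmt16 (p : ℕ) :
    Nonempty (GeometricAlgebra p p ≃ₐ[ℝ] Matrix (Fin (2 ^ p)) (Fin (2 ^ p)) ℝ) := by
  obtain ⟨g, hg⟩ := exists_surjective_matrix_pow_two p
  let b := ((Pi.basisFun ℝ (Fin p ⊕ Fin p)).reindex finSumFinEquiv).ExteriorAlgebra.map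
    (CliffordAlgebra.equivExterior (geomForm p p)).symm
  have : Module.Finite ℝ (GeometricAlgebra p p) := .of_basis b
  have hd : Module.finrank ℝ (GeometricAlgebra p p) =
      Module.finrank ℝ (Matrix (Fin (2 ^ p)) (Fin (2 ^ p)) ℝ) := by
    rw [Module.finrank_eq_card_basis b, Module.finrank_matrix]
    simp [← pow_add]
  exact ⟨AlgEquiv.ofBijective g
    ⟨(LinearMap.injective_iff_surjective_of_finrank_eq_finrank (f := g.toLinearMap) hd).2 hg, hg⟩⟩
end

section
/- The complexification of a real geometric algebra depends only on the total dimension: for all natural numbers p, q, p', q' with p + q = p' + q', the complex algebras ℂ ⊗_ℝ 𝒢_{p,q} and ℂ ⊗_ℝ 𝒢_{p',q'} are isomorphic as ℂ-algebras. -/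
/-- The bilinear form associated to a weighted sum of squares is the weighted dot product. -/
theorem associated_weightedSumSquares_apply {ι R : Type*} [Fintype ι] [CommRing R]
    [Invertible (2 : R)] (w x y : ι → R) :
    QuadraticMap.associated (QuadraticMap.weightedSumSquares R w) x y =
      ∑ i, w i * (x i * y i) := by
  rw [QuadraticMap.associated_apply]
  simp only [QuadraticMap.weightedSumSquares_apply, smul_eq_mul, Pi.add_apply,
    ← Finset.sum_sub_distrib]
  rw [Module.End.smul_def, QuadraticMap.half_moduleEnd_apply_eq_half_smul, smul_eq_mul,
    invOf_mul_eq_iff_eq_mul_left, Finset.mul_sum]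
  exact Finset.sum_congr rfl fun i _ => by ring

/-- The base change of a weighted sum of squares with nonzero weights is nondegenerate. -/
theorem separatingLeft_associated_baseChange_weightedSumSquares {ι K L : Type*} [Fintype ι]
    [Field K] [Field L] [Algebra K L] [Invertible (2 : K)] [Invertible (2 : L)] (w : ι → K)
    (hw : ∀ i, w i ≠ 0) :
    (QuadraticMap.associated (R := L)
      (QuadraticForm.baseChange L (QuadraticMap.weightedSumSquares K w))).SeparatingLeft := by
  classical
  rw [QuadraticForm.associated_baseChange]
  refine LinearMap.IsOrthoᵢ.separatingLeft_of_not_isOrtho_basis_self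
    ((Pi.basisFun K ι).baseChange L) ?_ ?_
  · rw [LinearMap.isOrthoᵢ_def]
    intro i j hij
    simp [associated_weightedSumSquares_apply, Pi.single_apply, hij.symm]
  · intro i
    simp [associated_weightedSumSquares_apply, Pi.single_apply, hw i]

open TensorProduct in
/-- The complexification of the form of signature `(p, q)` is equivalent to a sum of `p + q`
squares. -/
theorem geomForm_baseChange_equivalent (p q n : ℕ) (hn : p + q = n) :
    ((geomForm p q).baseChange ℂ).Equivalent
      (QuadraticMap.weightedSumSquares ℂ (1 : Fin n → ℂ)) := by
  have hrank : Module.finrank ℂ (ℂ ⊗[ℝ] ((Fin p ⊕ Fin q) → ℝ)) = n := by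
    simp [hn]
  subst hrank
  refine QuadraticForm.equivalent_weightedSumSquares_of_isAlgClosed _
    (separatingLeft_associated_baseChange_weightedSumSquares _ ?_)
  rintro (i | i) <;> simp

open TensorProduct in
theorem stmt19 (p q p' q' : ℕ) (h : p + q = p' + q') :
    Nonempty ((ℂ ⊗[ℝ] GeometricAlgebra p q) ≃ₐ[ℂ] (ℂ ⊗[ℝ] GeometricAlgebra p' q')) := by
  obtain ⟨e⟩ := (geomForm_baseChange_equivalent p q _ h).trans
    (geomForm_baseChange_equivalent p' q' _ rfl).symm
  exact ⟨(CliffordAlgebra.equivBaseChange ℂ (geomForm p q)).symm.trans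
    ((CliffordAlgebra.equivOfIsometry e).trans
      (CliffordAlgebra.equivBaseChange ℂ (geomForm p' q')))⟩
end
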